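/- In the stationary ergodic environment setting, let β ≥ 0, G ∈ 𝒢_sqc with monotonicity constant η > 0, and for λ ≥ β let u₊^λ, u₋^λ : ℝ × Ω → ℝ be jointly measurable functions such that for every ω, u₊^λ(·,ω) and u₋^λ(·,ω) are the unique elements of 𝒮^λ_+(ω) and 𝒮^λ_−(ω) vanishing at 0. Define θ₊(λ) := 𝔼[∂_x u₊^λ(0,·)] and θ₋(λ) := 𝔼[∂_x u₋^λ(0,·)] (well defined since for ℙ-a.e. ω the Lipschitz function u₊^λ(·,ω), resp. u₋^λ(·,ω), is differentiable at 0 with bounded derivative). Then: (i) θ₋(λ) ∈ [G_−^{-1}(λ), G_−^{-1}(λ−β)] and θ₊(λ) ∈ [G_+^{-1}(λ−β), G_+^{-1}(λ)] for every λ ≥ β; (ii) for every λ₂ > λ₁ ≥ β, (λ₂−λ₁)/C_R ≤ θ₋(λ₁) − θ₋(λ₂) ≤ (λ₂−λ₁)/η and (λ₂−λ₁)/C_R ≤ θ₊(λ₂) − θ₊(λ₁) ≤ (λ₂−λ₁)/η, where R := max{−G_−^{-1}(λ₂), G_+^{-1}(λ₂)} and C_R is a Lipschitz constant of G on [−R,R].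 In particular, λ ↦ θ₊(λ) is strictly increasing and λ ↦ θ₋(λ) is strictly decreasing, both locally Lipschitz and coercive on [β,+∞). -/

import Mathlib

open Real Set MeasureTheory

noncomputable section

/-- The class 𝒢(α₀,α₁,γ): growth condition (G1) and local Lipschitz condition (G2). -/
def MemG (α₀ α₁ γ : ℝ) (G : ℝ → ℝ) : Prop :=
  (∀ p : ℝ, α₀ * |p| ^ γ - 1 / α₀ ≤ G p ∧ G p ≤ α₁ * (|p| ^ γ + 1)) ∧
  (∀ p q : ℝ, |G p - G q| ≤ α₁ * (|p| + |q| + 1) ^ (γ - 1) * |p - q|)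

/-- The class 𝒢: union of the classes 𝒢(α₀,α₁,γ). -/
def MemGclass (G : ℝ → ℝ) : Prop :=
  ∃ α₀ α₁ γ : ℝ, 0 < α₀ ∧ 0 < α₁ ∧ 1 < γ ∧ MemG α₀ α₁ γ G

/-- Condition (G4): strict monotonicity with rate η on both half-lines. -/
def StrictIncrRate (G : ℝ → ℝ) (η : ℝ) : Prop :=
  ∀ p₁ p₂ : ℝ, 0 ≤ p₁ → p₁ < p₂ →
    η * (p₂ - p₁) ≤ G p₂ - G p₁ ∧ η * (p₂ - p₁) ≤ G (-p₂) - G (-p₁)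

/-- The class 𝒢_sqc: G ∈ 𝒢, G(0) = 0 and (G4) for some η > 0. -/
def MemGsqc (G : ℝ → ℝ) : Prop :=
  MemGclass G ∧ G 0 = 0 ∧ ∃ η : ℝ, 0 < η ∧ StrictIncrRate G η

/-- G_+^{-1} : the inverse of the restriction of G to [0,∞). -/
def GplusInv (G : ℝ → ℝ) (y : ℝ) : ℝ := Function.invFunOn G (Set.Ici 0) y

/-- G_−^{-1} : the inverse of the restriction of G to (−∞,0]. -/
def GminusInv (G : ℝ → ℝ) (y : ℝ) : ℝ := Function.invFunOn G (Set.Iic 0) y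

/-- Viscosity subsolution of a(x)u'' + G(u') + βV(x) = λ on ℝ. -/
def IsViscSubsol (a V G : ℝ → ℝ) (β lam : ℝ) (u : ℝ → ℝ) : Prop :=
  ∀ x₀ : ℝ, ∀ φ : ℝ → ℝ, ContDiff ℝ 2 φ →
    IsLocalMax (fun x => u x - φ x) x₀ →
    lam ≤ a x₀ * deriv (deriv φ) x₀ + G (deriv φ x₀) + β * V x₀

/-- Viscosity supersolution of a(x)u'' + G(u') + βV(x) = λ on ℝ. -/
def IsViscSupersol (a V G : ℝ → ℝ) (β lam : ℝ) (u : ℝ → ℝ) : Prop :=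
  ∀ x₀ : ℝ, ∀ φ : ℝ → ℝ, ContDiff ℝ 2 φ →
    IsLocalMin (fun x => u x - φ x) x₀ →
    a x₀ * deriv (deriv φ) x₀ + G (deriv φ x₀) + β * V x₀ ≤ lam

/-- Continuous viscosity solution of a(x)u'' + G(u') + βV(x) = λ on ℝ. -/
def IsViscSol (a V G : ℝ → ℝ) (β lam : ℝ) (u : ℝ → ℝ) : Prop :=
  Continuous u ∧ IsViscSubsol a V G β lam u ∧ IsViscSupersol a V G β lam u

/-- The set 𝒮^λ_+ of Lipschitz viscosity solutions with
u'(x) ∈ [G_+^{-1}(λ−β), G_+^{-1}(λ)] for a.e. x ∈ ℝ. -/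
def Splus (a V G : ℝ → ℝ) (β lam : ℝ) : Set (ℝ → ℝ) :=
  {u | (∃ K : NNReal, LipschitzWith K u) ∧ IsViscSol a V G β lam u ∧
    ∀ᵐ x ∂(volume : Measure ℝ),
      deriv u x ∈ Set.Icc (GplusInv G (lam - β)) (GplusInv G lam)}

/-- The set 𝒮^λ_− of Lipschitz viscosity solutions with
u'(x) ∈ [G_−^{-1}(λ), G_−^{-1}(λ−β)] for a.e. x ∈ ℝ. -/
def Sminus (a V G : ℝ → ℝ) (β lam : ℝ) : Set (ℝ → ℝ) :=
  {u | (∃ K : NNReal, LipschitzWith K u) ∧ IsViscSol a V G β lam u ∧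
    ∀ᵐ x ∂(volume : Measure ℝ),
      deriv u x ∈ Set.Icc (GminusInv G lam) (GminusInv G (lam - β))}

/-- A continuous function admitting no strictly concave parabola touching it from above is convex. -/
lemma convexOn_of_quadratic_touching {l r : ℝ} {w : ℝ → ℝ} (hw : Continuous w)
    (h : ∀ x₀ ∈ Ioo l r, ∀ B C : ℝ,
      IsLocalMax (fun t => w t - (B * t + C * t ^ 2)) x₀ → 0 ≤ C) :
    ConvexOn ℝ (Ioo l r) w := by
  refine LinearOrder.convexOn_of_lt (convex_Ioo l r) ?_
  intro x hx y hy hxy α γ hα hγ hαγ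
  by_contra! hcon
  simp only [smul_eq_mul] at hcon
  set z := α * x + γ * y with hz
  have hγ' : γ = 1 - α := by linarith
  have hα1 : α < 1 := by linarith
  have hxz : x < z := by rw [hz, hγ']; nlinarith
  have hzy : z < y := by rw [hz, hγ']; nlinarith
  set m := (w y - w x) / (y - x) with hm
  have hyx : 0 < y - x := by linarith
  have hmyx : m * (y - x) = w y - w x := by rw [hm]; field_simp
  set D := w z - (w x + m * (z - x)) with hD
  have hDpos : 0 < D := by
    have : m * (z - x) = γ * (w y - w x) := by
      rw [← hmyx, hz, hγ']; ring
    rw [hD, this, hγ']; rw [hγ'] at hcon; linarith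
  set e := D / (2 * ((z - x) * (y - z))) with he
  have hq : 0 < (z - x) * (y - z) := mul_pos (by linarith) (by linarith)
  have hepos : 0 < e := by positivity
  have heq : e * ((z - x) * (y - z)) = D / 2 := by
    rw [he]; field_simp; exact div_self hq.ne'
  set ψ : ℝ → ℝ := fun t => w t - ((m + e * (x + y)) * t + (-e) * t ^ 2) with hψ
  have hψc : Continuous ψ := by fun_prop
  obtain ⟨t₀, ht₀, hmax⟩ := isCompact_Icc.exists_isMaxOn (nonempty_Icc.2 hxy.le) hψc.continuousOn
  have hzt : ψ z ≤ ψ t₀ := hmax ⟨hxz.le, hzy.le⟩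
  have hψz : ψ x < ψ z := by
    have : ψ z - ψ x = D - e * ((z - x) * (y - z)) := by simp only [hψ, hD]; ring
    linarith
  have hψxy : ψ y = ψ x := by
    have : ψ y - ψ x = w y - w x - m * (y - x) := by simp only [hψ]; ring
    linarith
  have h1 : x < t₀ := lt_of_le_of_ne ht₀.1 (by rintro rfl; linarith)
  have h2 : t₀ < y := lt_of_le_of_ne ht₀.2 (by rintro rfl; linarith)
  have := h t₀ ⟨hx.1.trans h1, h2.trans hy.2⟩ _ _ (hmax.isLocalMax (Icc_mem_nhds h1 h2))
  linarith

/-- If both `M x² + u` and `M x² - u` are convex, then `u` is differentiable. -/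
lemma differentiableAt_of_semiconvex {l r M : ℝ} {u : ℝ → ℝ}
    (h1 : ConvexOn ℝ (Ioo l r) (fun t => u t + M * t ^ 2))
    (h2 : ConvexOn ℝ (Ioo l r) (fun t => -u t + M * t ^ 2)) {x : ℝ} (hx : x ∈ Ioo l r) :
    DifferentiableAt ℝ u x := by
  have hx' : x ∈ interior (Ioo l r) := by rwa [interior_Ioo]
  have hq : HasDerivAt (fun t : ℝ => M * t ^ 2) (M * (2 * x)) x := by
    simpa using (hasDerivAt_pow 2 x).const_mul M
  have key : ∀ v : ℝ → ℝ, ConvexOn ℝ (Ioo l r) (fun t => v t + M * t ^ 2) →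
      ∃ p q, p ≤ q ∧ HasDerivWithinAt v p (Iio x) x ∧ HasDerivWithinAt v q (Ioi x) x := by
    intro v hv
    refine ⟨_, _, ?_, (((hv.hasDerivWithinAt_leftDeriv_of_mem_interior hx').sub
      hq.hasDerivWithinAt).congr_of_eventuallyEq ?_ ?_),
      (((hv.hasDerivWithinAt_rightDeriv_of_mem_interior hx').sub
      hq.hasDerivWithinAt).congr_of_eventuallyEq ?_ ?_)⟩
    · linarith [hv.leftDeriv_le_rightDeriv_of_mem_interior hx']
    all_goals simp [Filter.EventuallyEq]
  obtain ⟨p, q, hpq, hp, hq'⟩ := key u h1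
  obtain ⟨p', q', hpq', hp', hq''⟩ := key _ h2
  have e1 : p' = -p := (uniqueDiffWithinAt_Iio x).eq_deriv _ hp' hp.neg
  have e2 : q' = -q := (uniqueDiffWithinAt_Ioi x).eq_deriv _ hq'' hq'.neg
  obtain rfl : p = q := by linarith
  have := hp.Iic_of_Iio.union hq'.Ici_of_Ioi
  rw [Iic_union_Ici, hasDerivWithinAt_univ] at this
  exact this.differentiableAt

lemma deriv_lipschitz_of_semiconvex {l r M : ℝ} {u : ℝ → ℝ}
    (h1 : ConvexOn ℝ (Ioo l r) (fun t => u t + M * t ^ 2))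
    (h2 : ConvexOn ℝ (Ioo l r) (fun t => -u t + M * t ^ 2)) {x y : ℝ}
    (hx : x ∈ Ioo l r) (hy : y ∈ Ioo l r) (hxy : x ≤ y) :
    |deriv u y - deriv u x| ≤ 2 * M * (y - x) := by
  have hd : ∀ x ∈ Ioo l r, DifferentiableAt ℝ u x := fun x hx =>
    differentiableAt_of_semiconvex h1 h2 hx
  have hq : ∀ x, HasDerivAt (fun t : ℝ => M * t ^ 2) (M * (2 * x)) x := fun x => by
    simpa using (hasDerivAt_pow 2 x).const_mul M
  have e1 : ∀ x ∈ Ioo l r, HasDerivAt (fun t => u t + M * t ^ 2) (deriv u x + M * (2 * x)) x :=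
    fun x hx => (hd x hx).hasDerivAt.add (hq x)
  have e2 : ∀ x ∈ Ioo l r,
      HasDerivAt (fun t => -u t + M * t ^ 2) (-deriv u x + M * (2 * x)) x :=
    fun x hx => (hd x hx).hasDerivAt.neg.add (hq x)
  have m1 := h1.monotoneOn_deriv (fun x hx => (e1 x hx).differentiableAt) hx hy hxy
  have m2 := h2.monotoneOn_deriv (fun x hx => (e2 x hx).differentiableAt) hx hy hxy
  rw [(e1 x hx).deriv, (e1 y hy).deriv] at m1
  rw [(e2 x hx).deriv, (e2 y hy).deriv] at m2
  rw [abs_le]; constructor <;> linarith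

/-- A continuous function which is both convex and concave has constant derivative. -/
lemma deriv_eq_of_convex_of_convex_neg {l r : ℝ} {w : ℝ → ℝ}
    (h1 : ConvexOn ℝ (Ioo l r) w) (h2 : ConvexOn ℝ (Ioo l r) (fun t => -w t)) {x y : ℝ}
    (hx : x ∈ Ioo l r) (hy : y ∈ Ioo l r) :
    deriv w x = deriv w y := by
  wlog hxy : x ≤ y generalizing x y
  · exact (this hy hx (le_of_not_ge hxy)).symm
  have := deriv_lipschitz_of_semiconvex (M := 0) (by simpa using h1) (by simpa using h2) hx hy hxy
  simp only [mul_zero, zero_mul] at this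
  linarith [abs_nonpos_iff.1 this]

/-- One-sided estimate for bounded solutions of the degenerate differential inequality
`a w' ≤ -ε` on `{a > 0} ∩ {w ≥ m + s}`. -/
lemma le_of_degenerate_ode {a w w' : ℝ → ℝ} {κ B m : ℝ} (hκ : 0 < κ)
    (ha0 : ∀ x, 0 ≤ a x) (ha1 : ∀ x, a x ≤ 1) (hac : Continuous a)
    (haq : ∀ x y, a x = 0 → a y ≤ κ ^ 2 * (y - x) ^ 2)
    (hB : ∀ x, |w x| ≤ B) (hw : ∀ x, 0 < a x → HasDerivAt w (w' x) x)
    (h : ∀ s > 0, ∃ ε > 0, ∀ x, 0 < a x → m + s ≤ w x → a x * w' x ≤ -ε)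
    {x₀ : ℝ} (hx₀ : 0 < a x₀) : w x₀ ≤ m := by
  by_contra! hlt
  have mono : ∀ y ≤ x₀, (∀ x ∈ Icc y x₀, 0 < a x) → w x₀ ≤ w y := by
    intro y hy hpos
    by_contra! hwy
    set L := max (w y) ((m + w x₀) / 2) with hL
    have hLx : L < w x₀ := max_lt hwy (by linarith)
    have hwc : ContinuousOn w (Icc y x₀) := fun x hx => (hw x (hpos x hx)).continuousAt.continuousWithinAt
    have hcl : IsClosed (Icc y x₀ ∩ w ⁻¹' Iic L) :=
      hwc.preimage_isClosed_of_isClosed isClosed_Icc isClosed_Iic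
    set S := Icc y x₀ ∩ w ⁻¹' Iic L with hS
    have hne : S.Nonempty := ⟨y, ⟨le_rfl, hy⟩, le_max_left (w y) ((m + w x₀) / 2)⟩
    have hbdd : BddAbove S := ⟨x₀, fun x hx => hx.1.2⟩
    have ht : sSup S ∈ S := hcl.csSup_mem hne hbdd
    set t := sSup S with htdef
    have htx : w t ≤ L := ht.2
    have hanti : AntitoneOn w (Icc t x₀) := by
      refine antitoneOn_of_deriv_nonpos (convex_Icc _ _)
        (hwc.mono (Icc_subset_Icc_left ht.1.1)) ?_ ?_
      · intro x hx
        rw [interior_Icc] at hx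
        exact (hw x (hpos x ⟨ht.1.1.trans hx.1.le, hx.2.le⟩)).differentiableAt.differentiableWithinAt
      · intro x hx
        rw [interior_Icc] at hx
        have hxI : x ∈ Icc y x₀ := ⟨ht.1.1.trans hx.1.le, hx.2.le⟩
        have hax := hpos x hxI
        rw [(hw x hax).deriv]
        have hwx : L < w x := by
          by_contra! hle
          exact absurd (le_csSup hbdd ⟨hxI, hle⟩) (not_le.2 hx.1)
        obtain ⟨ε, hε, hh⟩ := h ((w x₀ - m) / 2) (by linarith)
        have := hh x hax (by linarith [le_max_right (w y) ((m + w x₀) / 2)])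
        by_contra! hc
        nlinarith [mul_pos hax hc]
    have := hanti ⟨le_rfl, ht.1.2⟩ ⟨ht.1.2, le_rfl⟩ ht.1.2
    linarith
  obtain ⟨ε, hε, hh⟩ := h (w x₀ - m) (by linarith)
  have barrier : ∀ (y : ℝ) (b b' : ℝ → ℝ), y ≤ x₀ → (∀ x ∈ Icc y x₀, 0 < a x) →
      (∀ x ∈ Icc y x₀, HasDerivAt b (b' x) x) → (∀ x ∈ Icc y x₀, a x * b' x ≤ 1) →
      ε * (b x₀ - b y) ≤ 2 * B := by
    intro y b b' hy hpos hb hb1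
    have hd : ∀ x ∈ Icc y x₀, HasDerivAt (fun x => w x + ε * b x) (w' x + ε * b' x) x :=
      fun x hx => (hw x (hpos x hx)).add ((hb x hx).const_mul ε)
    have hanti : AntitoneOn (fun x => w x + ε * b x) (Icc y x₀) := by
      refine antitoneOn_of_deriv_nonpos (convex_Icc _ _)
        (fun x hx => (hd x hx).continuousAt.continuousWithinAt)
        (fun x hx => (hd x (interior_subset hx)).differentiableAt.differentiableWithinAt) ?_
      intro x hx
      have hx := interior_subset hx
      rw [(hd x hx).deriv]
      have hax := hpos x hx
      have h1 := hh x hax (by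
        have := mono x hx.2 (fun z hz => hpos z ⟨hx.1.trans hz.1, hz.2⟩)
        linarith)
      by_contra! hc
      have h2 := mul_pos hax hc
      have h3 := mul_le_mul_of_nonneg_left (hb1 x hx) hε.le
      linarith
    have := hanti ⟨le_rfl, hy⟩ ⟨hy, le_rfl⟩ hy
    have b1 := abs_le.1 (hB x₀)
    have b2 := abs_le.1 (hB y)
    linarith
  have hB0 : 0 ≤ B := (abs_nonneg _).trans (hB 0)
  by_cases hZ : ∃ z ≤ x₀, a z = 0
  · have hcl : IsClosed (Iic x₀ ∩ a ⁻¹' {0}) := isClosed_Iic.inter (isClosed_singleton.preimage hac)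
    obtain ⟨z, hz, hz0⟩ := hZ
    have hbdd : BddAbove (Iic x₀ ∩ a ⁻¹' {0}) := ⟨x₀, fun x hx => hx.1⟩
    have hℓ := hcl.csSup_mem ⟨z, hz, hz0⟩ hbdd
    set ℓ := sSup (Iic x₀ ∩ a ⁻¹' {0}) with hℓd
    have hℓ0 : a ℓ = 0 := hℓ.2
    have hℓx : ℓ < x₀ := lt_of_le_of_ne hℓ.1 (by rintro heq; rw [heq] at hℓ0; linarith)
    have hpos : ∀ x, ℓ < x → x ≤ x₀ → 0 < a x := by
      intro x hx hx'
      refine lt_of_le_of_ne (ha0 x) fun h0 => ?_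
      exact absurd (le_csSup hbdd ⟨hx', h0.symm⟩) (not_le.2 hx)
    set d := x₀ - ℓ with hd
    have hdpos : 0 < d := by linarith
    set N := 1 / d + κ ^ 2 * (2 * B + 1) / ε with hN
    have hNd : 1 / d ≤ N := by rw [hN]; linarith [show 0 ≤ κ ^ 2 * (2 * B + 1) / ε by positivity]
    have hNpos : 0 < N := lt_of_lt_of_le (by positivity) hNd
    have hy : ℓ + 1 / N ≤ x₀ := by
      have : 1 / N ≤ d := by rw [div_le_iff₀ hNpos]; rw [div_le_iff₀ hdpos] at hNd; linarith
      linarith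
    have hNi : 0 < 1 / N := by positivity
    have := barrier (ℓ + 1 / N) (fun x => -(κ ^ 2)⁻¹ * (x - ℓ)⁻¹)
      (fun x => (κ ^ 2)⁻¹ * ((x - ℓ) ^ 2)⁻¹) hy
      (fun x hx => hpos x (by linarith [hx.1]) hx.2) ?_ ?_
    · have e : -(κ ^ 2)⁻¹ * (x₀ - ℓ)⁻¹ - -(κ ^ 2)⁻¹ * (ℓ + 1 / N - ℓ)⁻¹ = (2 * B + 1) / ε := by
        rw [add_sub_cancel_left, ← hd, one_div, inv_inv, hN]
        field_simp
        ring
      rw [e, mul_div_cancel₀ _ hε.ne'] at this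
      linarith
    · intro x hx
      have hne : x - ℓ ≠ 0 := by linarith [hx.1]
      have := (((hasDerivAt_id x).sub_const ℓ).inv hne).const_mul (-(κ ^ 2)⁻¹)
      refine this.congr_deriv ?_
      simp only [id]
      ring
    · intro x hx
      have hne : 0 < x - ℓ := by linarith [hx.1]
      have := haq ℓ x hℓ0
      rw [← mul_inv, ← div_eq_mul_inv, div_le_one (by positivity)]
      exact this
  · push Not at hZ
    have hpos : ∀ x ≤ x₀, 0 < a x := fun x hx => lt_of_le_of_ne (ha0 x) (hZ x hx).symm
    have := barrier (x₀ - (2 * B + 1) / ε) id (fun _ => 1)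
      (by linarith [show 0 ≤ (2 * B + 1) / ε by positivity])
      (fun x hx => hpos x hx.2) (fun x _ => hasDerivAt_id x) (fun x _ => by simpa using ha1 x)
    simp only [id, sub_sub_cancel, mul_div_cancel₀ _ hε.ne'] at this
    linarith

/-- Viscosity subsolutions of `a u'' + H(x, u') = 0` on `ℝ`. -/
def IsDegenSub (a : ℝ → ℝ) (H : ℝ → ℝ → ℝ) (u : ℝ → ℝ) : Prop :=
  ∀ x₀ : ℝ, ∀ φ : ℝ → ℝ, ContDiff ℝ 2 φ → IsLocalMax (fun x => u x - φ x) x₀ →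
    0 ≤ a x₀ * deriv (deriv φ) x₀ + H x₀ (deriv φ x₀)

lemma deriv_quadratic (B C : ℝ) :
    deriv (fun t : ℝ => B * t + C * t ^ 2) = fun t => B + 2 * C * t := by
  funext t
  have := ((hasDerivAt_id t).const_mul B).add ((hasDerivAt_pow 2 t).const_mul C)
  refine (this.congr_deriv ?_).deriv
  simp; ring

lemma deriv_deriv_quadratic (B C t : ℝ) :
    deriv (deriv (fun t : ℝ => B * t + C * t ^ 2)) t = 2 * C := by
  rw [deriv_quadratic]
  have := ((hasDerivAt_id t).const_mul (2 * C)).const_add B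
  simp only [id, mul_one] at this
  exact this.deriv

/-- At a differentiability point where the diffusion vanishes quadratically, a viscosity
subsolution satisfies the first order inequality. -/
lemma IsDegenSub.nonneg_of_degenerate {a : ℝ → ℝ} {H : ℝ → ℝ → ℝ} {u : ℝ → ℝ} {κ p x₀ : ℝ}
    (hu : IsDegenSub a H u) (huc : Continuous u) (hH : Continuous (Function.uncurry H))
    (ha : ∀ y, a y ≤ κ ^ 2 * (y - x₀) ^ 2) (hp : HasDerivAt u p x₀) : 0 ≤ H x₀ p := by
  by_contra! hneg
  obtain ⟨r, hr, hball⟩ : ∃ r > 0, ∀ x q, |x - x₀| < r → |q - p| < r → H x q < H x₀ p / 2 := by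
    have hlt : ∀ᶠ z in nhds (x₀, p), Function.uncurry H z < H x₀ p / 2 :=
      hH.continuousAt.eventually_lt continuousAt_const (by simp; linarith)
    obtain ⟨r, hr, h⟩ := Metric.eventually_nhds_iff.1 hlt
    refine ⟨r, hr, fun x q hx hq => h (y := (x, q)) ?_⟩
    rw [Prod.dist_eq]
    exact max_lt hx hq
  set e := r / 4 with he
  have hepos : 0 < e := by positivity
  obtain ⟨ρ, hρ, hdiff⟩ : ∃ ρ > 0, ∀ x, |x - x₀| < ρ →
      |u x - u x₀ - (x - x₀) * p| ≤ e * |x - x₀| := by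
    have := (hasDerivAt_iff_isLittleO.1 hp).def hepos
    obtain ⟨ρ, hρ, h⟩ := Metric.eventually_nhds_iff.1 this
    exact ⟨ρ, hρ, fun x hx => by simpa using h (y := x) hx⟩
  set σ := min ρ r / 2 with hσ
  have hσpos : 0 < σ := by positivity
  have hσρ : σ < ρ := by linarith [min_le_left ρ r, show 0 < min ρ r by positivity]
  have hσr : σ < r := by linarith [min_le_right ρ r, show 0 < min ρ r by positivity]
  set μ := -(H x₀ p) / 2 with hμ
  have hμpos : 0 < μ := by rw [hμ]; linarith
  obtain ⟨ε, hε, hε1, hε2⟩ : ∃ ε > 0, 2 * e * ε < σ ∧ 4 * κ ^ 2 * e ^ 2 * ε < μ := by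
    refine ⟨min (σ / (2 * e) / 2) (μ / (4 * κ ^ 2 * e ^ 2 + 1) / 2), by positivity, ?_, ?_⟩
    · have h1 := min_le_left (σ / (2 * e) / 2) (μ / (4 * κ ^ 2 * e ^ 2 + 1) / 2)
      have h2 := mul_le_mul_of_nonneg_left h1 (show 0 ≤ 2 * e by positivity)
      have h3 : 2 * e * (σ / (2 * e) / 2) = σ / 2 := by field_simp
      linarith
    · have h1 := min_le_right (σ / (2 * e) / 2) (μ / (4 * κ ^ 2 * e ^ 2 + 1) / 2)
      have h2 := mul_le_mul_of_nonneg_left h1 (show 0 ≤ 4 * κ ^ 2 * e ^ 2 + 1 by positivity)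
      have h3 : (4 * κ ^ 2 * e ^ 2 + 1) * (μ / (4 * κ ^ 2 * e ^ 2 + 1) / 2) = μ / 2 := by
        field_simp
      have h4 : 0 < min (σ / (2 * e) / 2) (μ / (4 * κ ^ 2 * e ^ 2 + 1) / 2) := by positivity
      linarith
  set C := 1 / (2 * ε) with hC
  have hCpos : 0 < C := by positivity
  have hCε : 2 * C * ε = 1 := by rw [hC]; field_simp
  set B := p - 2 * C * x₀ with hB
  have hψc : Continuous (fun t => u t - (B * t + C * t ^ 2)) := by fun_prop
  obtain ⟨y, hy, hmax⟩ := isCompact_Icc.exists_isMaxOn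
    (nonempty_Icc.2 (show x₀ - σ ≤ x₀ + σ by linarith)) hψc.continuousOn
  have hcmp : u x₀ - (B * x₀ + C * x₀ ^ 2) ≤ u y - (B * y + C * y ^ 2) :=
    hmax ⟨by linarith, by linarith⟩
  have hyσ : |y - x₀| ≤ σ := by rw [abs_le]; constructor <;> linarith [hy.1, hy.2]
  have hdy := (abs_le.1 (hdiff y (by linarith))).2
  have hCy : C * |y - x₀| ^ 2 ≤ e * |y - x₀| := by
    rw [sq_abs]
    have : u y - u x₀ - (y - x₀) * p - C * (y - x₀) ^ 2 ≥ 0 := by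
      rw [hB] at hcmp; nlinarith
    linarith
  have hyε : |y - x₀| ≤ 2 * e * ε := by
    rcases (abs_nonneg (y - x₀)).eq_or_lt with h0 | h0
    · rw [← h0]; positivity
    · have : C * |y - x₀| ≤ e := by
        by_contra! hc
        nlinarith [mul_lt_mul_of_pos_right hc h0]
      have h5 := mul_le_mul_of_nonneg_left this (show 0 ≤ 2 * ε by positivity)
      calc |y - x₀| = 2 * C * ε * |y - x₀| := by rw [hCε, one_mul]
        _ = 2 * ε * (C * |y - x₀|) := by ring
        _ ≤ 2 * ε * e := h5
        _ = 2 * e * ε := by ring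
  have hlt : |y - x₀| < σ := by linarith
  rw [abs_lt] at hlt
  have hloc := hmax.isLocalMax (Icc_mem_nhds (by linarith [hlt.1]) (by linarith [hlt.2]))
  have hsub := hu y _ (by fun_prop) hloc
  rw [deriv_deriv_quadratic, deriv_quadratic] at hsub
  have hq : |B + 2 * C * y - p| < r := by
    have : B + 2 * C * y - p = 2 * C * (y - x₀) := by rw [hB]; ring
    rw [this, abs_mul, abs_of_pos (by positivity)]
    have h6 := mul_le_mul_of_nonneg_left hyε (show 0 ≤ 2 * C by positivity)
    have : 2 * C * (2 * e * ε) = 2 * e := by linear_combination 2 * e * hCε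
    rw [this] at h6
    linarith
  have hHy := hball y _ (by linarith [abs_lt.2 hlt]) hq
  have hay : a y * (2 * C) < μ := by
    have h7 : a y ≤ κ ^ 2 * (2 * e * ε) ^ 2 := by
      refine (ha y).trans (mul_le_mul_of_nonneg_left ?_ (by positivity))
      rw [← sq_abs]
      exact pow_le_pow_left₀ (abs_nonneg _) hyε 2
    have h8 := mul_le_mul_of_nonneg_right h7 (show 0 ≤ 2 * C by positivity)
    have : κ ^ 2 * (2 * e * ε) ^ 2 * (2 * C) = 4 * κ ^ 2 * e ^ 2 * ε := by
      linear_combination 4 * κ ^ 2 * e ^ 2 * ε * hCε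
    linarith
  rw [hμ] at hay
  linarith

/-- A `C¹` function touching a `K`-Lipschitz function has slope at most `K` there. -/
lemma abs_le_of_touching {u φ : ℝ → ℝ} {K p x₀ : ℝ} (hu : ∀ x y, |u x - u y| ≤ K * |x - y|)
    (hφ : HasDerivAt φ p x₀) (hmax : IsLocalMax (fun x => u x - φ x) x₀) : |p| ≤ K := by
  have hs := hasDerivAt_iff_tendsto_slope.1 hφ
  rw [abs_le]
  constructor
  · refine ge_of_tendsto (hs.mono_left (nhdsWithin_mono x₀ (fun x hx => ne_of_gt hx) :
      nhdsWithin x₀ (Ioi x₀) ≤ _)) ?_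
    filter_upwards [self_mem_nhdsWithin, nhdsWithin_le_nhds hmax] with x hx hm
    have hx : 0 < x - x₀ := sub_pos.2 hx
    have h := (abs_le.1 (hu x x₀)).1
    rw [abs_of_pos hx] at h
    rw [slope_def_field, le_div_iff₀ hx]
    linarith
  · refine le_of_tendsto (hs.mono_left (nhdsWithin_mono x₀ (fun x hx => ne_of_lt hx) :
      nhdsWithin x₀ (Iio x₀) ≤ _)) ?_
    filter_upwards [self_mem_nhdsWithin, nhdsWithin_le_nhds hmax] with x hx hm
    have hx : x - x₀ < 0 := sub_neg.2 hx
    have h := (abs_le.1 (hu x x₀)).1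
    rw [abs_of_neg hx] at h
    rw [slope_def_field, div_le_iff_of_neg hx]
    linarith

/-- Lipschitz subsolutions are semiconvex where the diffusion is uniformly positive. -/
lemma IsDegenSub.exists_semiconvex {a : ℝ → ℝ} {H : ℝ → ℝ → ℝ} {u : ℝ → ℝ} {K l r a₀ : ℝ}
    (hu : IsDegenSub a H u) (huK : ∀ x y, |u x - u y| ≤ K * |x - y|) (huc : Continuous u)
    (hH : Continuous (Function.uncurry H)) (ha₀ : 0 < a₀) (ha : ∀ x ∈ Ioo l r, a₀ ≤ a x) :
    ∃ M, ∀ M' ≥ M, ConvexOn ℝ (Ioo l r) (fun t => u t + M' * t ^ 2) := by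
  obtain ⟨N, hN⟩ := ((isCompact_Icc (a := l) (b := r)).prod (isCompact_Icc (a := -K) (b := K)))
    |>.bddAbove_image hH.continuousOn
  set N' := max N 0 with hN'
  refine ⟨N' / (2 * a₀), fun M hM => convexOn_of_quadratic_touching (by fun_prop) ?_⟩
  intro x₀ hx₀ B C hmax
  have hmax' : IsLocalMax (fun t => u t - (B * t + (C - M) * t ^ 2)) x₀ := by
    convert hmax using 2 with t
    ring
  have hsub := hu x₀ _ (by fun_prop) hmax'
  have hd : HasDerivAt (fun t : ℝ => B * t + (C - M) * t ^ 2) (B + 2 * (C - M) * x₀) x₀ := by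
    have h : DifferentiableAt ℝ (fun t : ℝ => B * t + (C - M) * t ^ 2) x₀ := by fun_prop
    have := h.hasDerivAt
    rwa [deriv_quadratic] at this
  have hq := abs_le.1 (abs_le_of_touching huK hd hmax')
  rw [deriv_deriv_quadratic, deriv_quadratic] at hsub
  have hHN : H x₀ (B + 2 * (C - M) * x₀) ≤ N :=
    hN ⟨(x₀, B + 2 * (C - M) * x₀), ⟨⟨hx₀.1.le, hx₀.2.le⟩, hq⟩, rfl⟩
  have hax := ha x₀ hx₀
  by_contra! hC
  have hM' : N' ≤ M * (2 * a₀) := (div_le_iff₀ (by positivity)).1 hM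
  have hNN : N ≤ N' := le_max_left _ _
  have hN0 : 0 ≤ N' := le_max_right _ _
  have hM0 : 0 ≤ M := le_trans (by positivity) hM
  nlinarith [mul_le_mul_of_nonneg_right hax (show 0 ≤ M - C by linarith), mul_pos ha₀ (neg_pos.2 hC)]

lemma IsDegenSub.convexOn_sub {a : ℝ → ℝ} {H : ℝ → ℝ → ℝ} {u U : ℝ → ℝ} {l r : ℝ}
    (hu : IsDegenSub a H u) (huc : Continuous u) (ha : ∀ x ∈ Ioo l r, 0 < a x)
    (hd : ∀ x ∈ Ioo l r, DifferentiableAt ℝ u x) (hU : ContDiff ℝ 2 U)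
    (hUH : ∀ x ∈ Ioo l r, a x * deriv (deriv U) x = -H x (deriv u x)) :
    ConvexOn ℝ (Ioo l r) (fun t => u t - U t) := by
  have hUd : Differentiable ℝ U := hU.differentiable (by norm_num)
  have hU' : Differentiable ℝ (deriv U) :=
    ((contDiff_succ_iff_deriv (n := 1)).1 (by rw [one_add_one_eq_two]; exact hU)).2.2.differentiable (by norm_num)
  refine convexOn_of_quadratic_touching (huc.sub hU.continuous) ?_
  intro x₀ hx₀ B C hmax
  have hq : Differentiable ℝ (fun t : ℝ => B * t + C * t ^ 2) := by fun_prop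
  have hq' : Differentiable ℝ (deriv (fun t : ℝ => B * t + C * t ^ 2)) := by
    rw [deriv_quadratic]; fun_prop
  set φ : ℝ → ℝ := fun t => U t + (B * t + C * t ^ 2) with hφ
  have hmax' : IsLocalMax (fun t => u t - φ t) x₀ := by
    convert hmax using 2 with t
    simp only [hφ]; ring
  have hφc : ContDiff ℝ 2 φ := hU.add (by fun_prop)
  have hsub := hu x₀ φ hφc hmax'
  have e1 : deriv φ = fun t => deriv U t + deriv (fun t : ℝ => B * t + C * t ^ 2) t := by
    funext t
    exact deriv_add (hUd t) (hq t)
  have e2 : deriv (deriv φ) x₀ = deriv (deriv U) x₀ + 2 * C := by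
    rw [e1, ← deriv_deriv_quadratic B C x₀]
    exact deriv_add (hU' x₀) (hq' x₀)
  have e3 : deriv u x₀ - deriv φ x₀ = 0 :=
    hmax'.hasDerivAt_eq_zero ((hd x₀ hx₀).hasDerivAt.sub
      (hφc.differentiable (by norm_num) x₀).hasDerivAt)
  rw [e2, ← sub_eq_zero.1 e3, mul_add, hUH x₀ hx₀] at hsub
  have := ha x₀ hx₀
  by_contra! hC
  nlinarith [mul_pos this (neg_pos.2 hC)]

lemma exists_second_primitive {g : ℝ → ℝ} (hg : Continuous g) :
    ∃ U : ℝ → ℝ, ContDiff ℝ 2 U ∧ ∀ x, HasDerivAt (deriv U) (g x) x := by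
  set F : ℝ → ℝ := fun x => ∫ t in (0 : ℝ)..x, g t with hF
  have hFd : ∀ x, HasDerivAt F (g x) x := fun x =>
    intervalIntegral.integral_hasDerivAt_right (hg.intervalIntegrable _ _)
      (hg.stronglyMeasurableAtFilter _ _) hg.continuousAt
  have hFc : Continuous F := continuous_iff_continuousAt.2 fun x => (hFd x).continuousAt
  set U : ℝ → ℝ := fun x => ∫ t in (0 : ℝ)..x, F t with hU
  have hUd : ∀ x, HasDerivAt U (F x) x := fun x =>
    intervalIntegral.integral_hasDerivAt_right (hFc.intervalIntegrable _ _)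
      (hFc.stronglyMeasurableAtFilter _ _) hFc.continuousAt
  have e1 : deriv U = F := funext fun x => (hUd x).deriv
  have e2 : deriv F = g := funext fun x => (hFd x).deriv
  refine ⟨U, ?_, fun x => e1 ▸ hFd x⟩
  have : ContDiff ℝ (1 + 1) U := by
    refine contDiff_succ_iff_deriv.2 ⟨fun x => (hUd x).differentiableAt, by simp, ?_⟩
    rw [e1, contDiff_one_iff_deriv, e2]
    exact ⟨fun x => (hFd x).differentiableAt, hg⟩
  simpa [one_add_one_eq_two] using this

/-- Interior regularity: Lipschitz viscosity solutions of `a u'' + H(x, u') = 0` are twice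
differentiable classical solutions on `{a > 0}`. -/
lemma hasDerivAt_deriv_of_viscosity {a : ℝ → ℝ} {H : ℝ → ℝ → ℝ} {u : ℝ → ℝ} {K x₀ : ℝ}
    (hsub : IsDegenSub a H u) (hsup : IsDegenSub a (fun x p => -H x (-p)) (fun x => -u x))
    (huK : ∀ x y, |u x - u y| ≤ K * |x - y|) (huc : Continuous u) (hac : Continuous a)
    (hH : Continuous (Function.uncurry H)) (hx₀ : 0 < a x₀) :
    DifferentiableAt ℝ u x₀ ∧ HasDerivAt (deriv u) (-H x₀ (deriv u x₀) / a x₀) x₀ := by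
  obtain ⟨ρ, hρ, hball⟩ : ∃ ρ > 0, ∀ x, |x - x₀| < ρ → a x₀ / 2 < a x := by
    have : ∀ᶠ x in nhds x₀, a x₀ / 2 < a x :=
      continuousAt_const.eventually_lt hac.continuousAt (by linarith)
    obtain ⟨ρ, hρ, h⟩ := Metric.eventually_nhds_iff.1 this
    exact ⟨ρ, hρ, fun x hx => h (y := x) hx⟩
  have ha : ∀ x ∈ Ioo (x₀ - ρ) (x₀ + ρ), a x₀ / 2 ≤ a x := fun x hx =>
    (hball x (abs_lt.2 ⟨by linarith [hx.1], by linarith [hx.2]⟩)).le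
  have hH' : Continuous (Function.uncurry fun x p => -H x (-p)) := by
    have : Continuous fun z : ℝ × ℝ => -Function.uncurry H (z.1, -z.2) := by fun_prop
    exact this
  obtain ⟨M₁, hM₁⟩ := hsub.exists_semiconvex huK huc hH (half_pos hx₀) ha
  obtain ⟨M₂, hM₂⟩ := hsup.exists_semiconvex (K := K)
    (fun x y => by rw [neg_sub_neg, abs_sub_comm]; exact huK x y) huc.neg hH' (half_pos hx₀) ha
  set M := max (max M₁ M₂) 0 with hM
  have c1 := hM₁ M ((le_max_left _ _).trans (le_max_left _ _))
  have c2 := hM₂ M ((le_max_right _ _).trans (le_max_left _ _))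
  have hd : ∀ x ∈ Ioo (x₀ - ρ) (x₀ + ρ), DifferentiableAt ℝ u x := fun x hx =>
    differentiableAt_of_semiconvex c1 c2 hx
  have hlip : LipschitzOnWith (Real.toNNReal (2 * M)) (deriv u) (Ioo (x₀ - ρ) (x₀ + ρ)) := by
    refine LipschitzOnWith.of_dist_le_mul fun x hx y hy => ?_
    rw [Real.coe_toNNReal _ (by positivity), Real.dist_eq, Real.dist_eq]
    rcases le_total x y with h | h
    · rw [abs_sub_comm, abs_sub_comm x y, abs_of_nonneg (sub_nonneg.2 h)]
      exact deriv_lipschitz_of_semiconvex c1 c2 hx hy h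
    · rw [abs_of_nonneg (sub_nonneg.2 h)]
      exact deriv_lipschitz_of_semiconvex c1 c2 hy hx h
  have hsubset : Icc (x₀ - ρ / 2) (x₀ + ρ / 2) ⊆ Ioo (x₀ - ρ) (x₀ + ρ) := fun x hx =>
    ⟨by linarith [hx.1], by linarith [hx.2]⟩
  have hle : x₀ - ρ / 2 ≤ x₀ + ρ / 2 := by linarith
  have hapos : ∀ x ∈ Icc (x₀ - ρ / 2) (x₀ + ρ / 2), 0 < a x := fun x hx =>
    (half_pos hx₀).trans_le (ha x (hsubset hx))
  have hgc : ContinuousOn (fun x => -H x (deriv u x) / a x) (Icc (x₀ - ρ / 2) (x₀ + ρ / 2)) := by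
    refine ContinuousOn.div ?_ hac.continuousOn (fun x hx => (hapos x hx).ne')
    exact (hH.comp_continuousOn (continuousOn_id.prodMk (hlip.continuousOn.mono hsubset))).neg
  obtain ⟨U, hU, hUg⟩ := exists_second_primitive (hgc.domRestrict.Icc_extend' (h := hle))
  have hUg' : ∀ x ∈ Icc (x₀ - ρ / 2) (x₀ + ρ / 2),
      HasDerivAt (deriv U) (-H x (deriv u x) / a x) x := fun x hx => by
    have := hUg x
    rwa [IccExtend_of_mem _ _ hx] at this
  have hI : Ioo (x₀ - ρ / 2) (x₀ + ρ / 2) ⊆ Icc (x₀ - ρ / 2) (x₀ + ρ / 2) := Ioo_subset_Icc_self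
  have v1 := hsub.convexOn_sub huc (fun x hx => hapos x (hI hx)) (fun x hx => hd x (hsubset (hI hx)))
    hU (fun x hx => by
      rw [(hUg' x (hI hx)).deriv, mul_div_cancel₀ _ (hapos x (hI hx)).ne'])
  have v2 := hsup.convexOn_sub (U := fun x => -U x) huc.neg (fun x hx => hapos x (hI hx))
    (fun x hx => (hd x (hsubset (hI hx))).neg) hU.neg (fun x hx => by
      have e1 : deriv (fun x => -U x) = fun x => -deriv U x := funext fun x => deriv.fun_neg
      have e2 : deriv (fun x => -deriv U x) x = -deriv (deriv U) x := deriv.fun_neg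
      have e3 : deriv (fun x => -u x) x = -deriv u x := deriv.fun_neg
      rw [e1, e2, e3, (hUg' x (hI hx)).deriv, neg_neg, mul_neg,
        mul_div_cancel₀ _ (hapos x (hI hx)).ne', neg_neg, neg_neg])
  have hUd : Differentiable ℝ U := hU.differentiable (by norm_num)
  have hmem : x₀ ∈ Ioo (x₀ - ρ / 2) (x₀ + ρ / 2) := ⟨by linarith, by linarith⟩
  refine ⟨hd x₀ (hsubset (hI hmem)), ?_⟩
  have hev : deriv u =ᶠ[nhds x₀] fun x => deriv U x + (deriv u x₀ - deriv U x₀) := by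
    filter_upwards [Ioo_mem_nhds hmem.1 hmem.2] with x hx
    have h1 := deriv_eq_of_convex_of_convex_neg v1 (by convert v2 using 2 with t; ring) hx hmem
    have e : ∀ y ∈ Ioo (x₀ - ρ / 2) (x₀ + ρ / 2),
        deriv (fun t => u t - U t) y = deriv u y - deriv U y := fun y hy =>
      deriv_sub (hd y (hsubset (hI hy))) (hUd y)
    rw [e x hx, e x₀ hmem] at h1
    linarith
  exact ((hUg' x₀ (hI hmem)).add_const _).congr_of_eventuallyEq hev

lemma MemGclass.continuous {G : ℝ → ℝ} (hG : MemGclass G) : Continuous G := by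
  obtain ⟨α₀, α₁, γ, -, -, hγ, -, hL⟩ := hG
  refine continuous_iff_continuousAt.2 fun p => tendsto_iff_dist_tendsto_zero.2 ?_
  refine squeeze_zero (fun _ => dist_nonneg) (fun q => hL q p) ?_
  have hc : Continuous fun q : ℝ => α₁ * (|q| + |p| + 1) ^ (γ - 1) * |q - p| := by
    have : Continuous fun q : ℝ => (|q| + |p| + 1) ^ (γ - 1) :=
      Continuous.rpow_const (by fun_prop) fun q => Or.inr (by linarith)
    fun_prop
  simpa using hc.tendsto p

lemma MemGclass.exists_lipschitzOnWith {G : ℝ → ℝ} (hG : MemGclass G) (R : ℝ) :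
    ∃ C : ℝ, LipschitzOnWith (Real.toNNReal C) G (Icc (-R) R) := by
  obtain ⟨α₀, α₁, γ, -, hα₁, hγ, -, hL⟩ := hG
  refine ⟨α₁ * (R + R + 1) ^ (γ - 1), LipschitzOnWith.of_dist_le_mul fun p hp q hq => ?_⟩
  have hp := abs_le.2 hp
  have hq := abs_le.2 hq
  have hR : 0 ≤ R := (abs_nonneg p).trans hp
  rw [Real.coe_toNNReal _ (by positivity), Real.dist_eq, Real.dist_eq]
  refine (hL p q).trans ?_
  gcongr

lemma StrictIncrRate.le_sub {G : ℝ → ℝ} {η : ℝ} (h : StrictIncrRate G η) {p q : ℝ} (hp : 0 ≤ p)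
    (hpq : p ≤ q) : η * (q - p) ≤ G q - G p := by
  rcases hpq.eq_or_lt with rfl | hlt
  · simp
  · exact (h p q hp hlt).1

lemma GplusInv_spec {G : ℝ → ℝ} {η y : ℝ} (hη : 0 < η) (hG : MemGsqc G)
    (hmono : StrictIncrRate G η) (hy : 0 ≤ y) : 0 ≤ GplusInv G y ∧ G (GplusInv G y) = y := by
  have hex : ∃ p ∈ Ici (0 : ℝ), G p = y := by
    have hq : 0 ≤ y / η := by positivity
    have h1 := hmono.le_sub le_rfl hq
    rw [hG.2.1, sub_zero, sub_zero, mul_div_cancel₀ _ hη.ne'] at h1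
    obtain ⟨p, hp, hpy⟩ := intermediate_value_Icc hq hG.1.continuous.continuousOn
      (show y ∈ Icc (G 0) (G (y / η)) from ⟨by rw [hG.2.1]; exact hy, h1⟩)
    exact ⟨p, hp.1, hpy⟩
  exact ⟨Function.invFunOn_mem hex, Function.invFunOn_eq hex⟩

lemma le_of_G_le {G : ℝ → ℝ} {η p q : ℝ} (hη : 0 < η) (hmono : StrictIncrRate G η) (hq : 0 ≤ q)
    (h : G p ≤ G q) : p ≤ q := by
  by_contra! hlt
  nlinarith [hmono.le_sub hq hlt.le]

lemma GplusInv_mono {G : ℝ → ℝ} {η y z : ℝ} (hη : 0 < η) (hG : MemGsqc G)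
    (hmono : StrictIncrRate G η) (hy : 0 ≤ y) (hyz : y ≤ z) : GplusInv G y ≤ GplusInv G z := by
  obtain ⟨-, h1⟩ := GplusInv_spec hη hG hmono hy
  obtain ⟨h2, h3⟩ := GplusInv_spec hη hG hmono (hy.trans hyz)
  exact le_of_G_le hη hmono h2 (by rw [h1, h3]; exact hyz)

lemma quadratic_vanishing {a : ℝ → ℝ} {κ : ℝ} (hκ : 0 < κ) (ha0 : ∀ x, 0 ≤ a x)
    (ha : LipschitzWith (Real.toNNReal κ) (fun x => Real.sqrt (a x))) (x y : ℝ) (hx : a x = 0) :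
    a y ≤ κ ^ 2 * (y - x) ^ 2 := by
  have h := ha.dist_le_mul y x
  rw [hx, Real.sqrt_zero, Real.dist_eq, Real.dist_eq, sub_zero, Real.coe_toNNReal _ hκ.le,
    abs_of_nonneg (Real.sqrt_nonneg _)] at h
  have := pow_le_pow_left₀ (Real.sqrt_nonneg _) h 2
  rwa [Real.sq_sqrt (ha0 y), mul_pow, sq_abs] at this

lemma continuous_of_sqrt_lipschitz {a : ℝ → ℝ} {κ : NNReal} (ha0 : ∀ x, 0 ≤ a x)
    (ha : LipschitzWith κ (fun x => Real.sqrt (a x))) : Continuous a := by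
  have : a = fun x => Real.sqrt (a x) ^ 2 := funext fun x => (Real.sq_sqrt (ha0 x)).symm
  rw [this]
  exact ha.continuous.pow 2

lemma IsViscSol.isDegenSub {a V G : ℝ → ℝ} {β lam : ℝ} {u : ℝ → ℝ}
    (hu : IsViscSol a V G β lam u) : IsDegenSub a (fun x p => G p + β * V x - lam) u := by
  intro x₀ φ hφ hmax
  linarith [hu.2.1 x₀ φ hφ hmax]

lemma IsViscSol.isDegenSub_neg {a V G : ℝ → ℝ} {β lam : ℝ} {u : ℝ → ℝ}
    (hu : IsViscSol a V G β lam u) :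
    IsDegenSub a (fun x p => -(G (-p) + β * V x - lam)) (fun x => -u x) := by
  intro x₀ φ hφ hmax
  have hmin : IsLocalMin (fun x => u x - -φ x) x₀ := by
    filter_upwards [hmax] with y hy
    have hy : -u y - φ y ≤ -u x₀ - φ x₀ := hy
    change u x₀ - -φ x₀ ≤ u y - -φ y
    linarith
  have h := hu.2.2 x₀ (fun x => -φ x) hφ.neg hmin
  have e1 : deriv (fun x => -φ x) = fun x => -deriv φ x := funext fun x => deriv.fun_neg
  have e2 : deriv (fun x => -deriv φ x) x₀ = -deriv (deriv φ) x₀ := deriv.fun_neg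
  rw [e1, e2] at h
  linarith

/-- The pointwise information carried by an element of `Splus`. -/
lemma Splus_classical {a V G : ℝ → ℝ} {β lam κ : ℝ} {u : ℝ → ℝ} (hκ : 0 < κ)
    (hGc : Continuous G) (ha0 : ∀ x, 0 ≤ a x)
    (ha : LipschitzWith (Real.toNNReal κ) (fun x => Real.sqrt (a x))) (hV : Continuous V)
    (hu : u ∈ Splus a V G β lam) :
    (∀ x, 0 < a x → HasDerivAt (deriv u) ((lam - β * V x - G (deriv u x)) / a x) x ∧
      deriv u x ∈ Icc (GplusInv G (lam - β)) (GplusInv G lam)) ∧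
    (∀ᵐ x, a x = 0 → G (deriv u x) = lam - β * V x ∧
      deriv u x ∈ Icc (GplusInv G (lam - β)) (GplusInv G lam)) ∧
    ∃ K : ℝ, ∀ x, |deriv u x| ≤ K := by
  obtain ⟨⟨K, hK⟩, hsol, hae⟩ := hu
  have hH : Continuous (Function.uncurry fun x p => G p + β * V x - lam) := by
    have : Continuous fun z : ℝ × ℝ => G z.2 + β * V z.1 - lam := by fun_prop
    exact this
  have hH' : Continuous (Function.uncurry fun x p => -(G (-p) + β * V x - lam)) := by
    have : Continuous fun z : ℝ × ℝ => -(G (-z.2) + β * V z.1 - lam) := by fun_prop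
    exact this
  have hK' : ∀ x y, |u x - u y| ≤ K * |x - y| := fun x y => by
    simpa [Real.dist_eq] using hK.dist_le_mul x y
  have hac := continuous_of_sqrt_lipschitz ha0 ha
  refine ⟨fun x hx => ?_, ?_, K, fun x => ?_⟩
  · have hd := (hasDerivAt_deriv_of_viscosity hsol.isDegenSub hsol.isDegenSub_neg hK' hsol.1 hac
      hH hx).2
    refine ⟨hd.congr_deriv (by congr 1; ring), ?_⟩
    have hdense : Dense {y | deriv u y ∈ Icc (GplusInv G (lam - β)) (GplusInv G lam)} :=
      Measure.dense_of_ae hae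
    exact isClosed_Icc.mem_of_frequently_of_tendsto
      (f := deriv u) (b := nhds x) (mem_closure_iff_frequently.1 (hdense x)) hd.continuousAt
  · filter_upwards [hae, hK.ae_differentiableAt_real] with x hx hdx hax
    refine ⟨?_, hx⟩
    have hq := fun y => quadratic_vanishing hκ ha0 ha x y hax
    have h1 := hsol.isDegenSub.nonneg_of_degenerate hsol.1 hH hq hdx.hasDerivAt
    have h2 := hsol.isDegenSub_neg.nonneg_of_degenerate hsol.1.neg hH' hq hdx.hasDerivAt.neg
    simp only [neg_neg] at h2
    linarith
  · simpa using norm_deriv_le_of_lipschitz hK (x₀ := x)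

/-- Quantitative comparison of the slopes of solutions at two different levels. -/
lemma ae_deriv_sub_mem_Icc {a V G : ℝ → ℝ} {β κ η lam₁ lam₂ R C : ℝ} {u₁ u₂ : ℝ → ℝ}
    (hκ : 0 < κ) (hη : 0 < η) (hG : MemGsqc G) (hmono : StrictIncrRate G η)
    (ha01 : ∀ x, a x ∈ Icc (0 : ℝ) 1)
    (ha : LipschitzWith (Real.toNNReal κ) (fun x => Real.sqrt (a x))) (hV : Continuous V)
    (hβ : 0 ≤ β) (h₁ : β ≤ lam₁) (h₁₂ : lam₁ < lam₂)
    (hu₁ : u₁ ∈ Splus a V G β lam₁) (hu₂ : u₂ ∈ Splus a V G β lam₂)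
    (hR : GplusInv G lam₂ ≤ R) (hC : LipschitzOnWith (Real.toNNReal C) G (Icc (-R) R)) :
    ∀ᵐ x, deriv u₂ x - deriv u₁ x ∈ Icc ((lam₂ - lam₁) / C) ((lam₂ - lam₁) / η) := by
  have ha0 : ∀ x, 0 ≤ a x := fun x => (ha01 x).1
  have hδ : 0 < lam₂ - lam₁ := by linarith
  obtain ⟨c1, d1, K₁, hK₁⟩ := Splus_classical hκ hG.1.continuous ha0 ha hV hu₁
  obtain ⟨c2, d2, K₂, hK₂⟩ := Splus_classical hκ hG.1.continuous ha0 ha hV hu₂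
  have b1 := GplusInv_spec hη hG hmono (show 0 ≤ lam₁ - β by linarith)
  have b2 := GplusInv_spec hη hG hmono (show 0 ≤ lam₂ - β by linarith)
  have b3 := GplusInv_mono hη hG hmono (hβ.trans h₁) h₁₂.le
  have b4 := GplusInv_spec hη hG hmono (show 0 ≤ lam₂ by linarith)
  have hlip : ∀ p q, 0 ≤ p → p ≤ q → q ≤ R → G q - G p ≤ max C 0 * (q - p) := by
    intro p q hp hpq hq
    have := hC.dist_le_mul q ⟨by linarith, hq⟩ p ⟨by linarith, by linarith⟩
    rw [Real.dist_eq, Real.dist_eq, abs_of_nonneg (sub_nonneg.2 hpq), Real.coe_toNNReal'] at this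
    exact (le_abs_self _).trans this
  have hCpos : 0 < C := by
    have := hlip 0 _ le_rfl b4.1 hR
    rw [b4.2, hG.2.1] at this
    by_contra! hle
    rw [max_eq_right hle] at this
    linarith
  rw [max_eq_left hCpos.le] at hlip
  have r1 : ∀ p ∈ Icc (GplusInv G (lam₁ - β)) (GplusInv G lam₁), 0 ≤ p ∧ p ≤ R := fun p hp =>
    ⟨b1.1.trans hp.1, hp.2.trans (b3.trans hR)⟩
  have r2 : ∀ p ∈ Icc (GplusInv G (lam₂ - β)) (GplusInv G lam₂), 0 ≤ p ∧ p ≤ R := fun p hp =>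
    ⟨b2.1.trans hp.1, hp.2.trans hR⟩
  have hac := continuous_of_sqrt_lipschitz ha0 ha
  have haq := quadratic_vanishing hκ ha0 ha
  have hwd : ∀ x, 0 < a x → HasDerivAt (fun x => deriv u₂ x - deriv u₁ x)
      ((lam₂ - lam₁ - (G (deriv u₂ x) - G (deriv u₁ x))) / a x) x := fun x hx =>
    ((c2 x hx).1.sub (c1 x hx).1).congr_deriv (by rw [← sub_div]; congr 1; ring)
  have hwB : ∀ x, |deriv u₂ x - deriv u₁ x| ≤ K₂ + K₁ := fun x =>
    (abs_sub _ _).trans (add_le_add (hK₂ x) (hK₁ x))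
  have hup : ∀ x, 0 < a x → deriv u₂ x - deriv u₁ x ≤ (lam₂ - lam₁) / η := by
    intro x hx
    refine le_of_degenerate_ode hκ ha0 (fun x => (ha01 x).2) hac haq hwB hwd ?_ hx
    intro s hs
    refine ⟨η * s, by positivity, fun x hx hws => ?_⟩
    rw [mul_div_cancel₀ _ hx.ne']
    have hpos : 0 < (lam₂ - lam₁) / η := by positivity
    have h := hmono.le_sub (r1 _ (c1 x hx).2).1
      (show deriv u₁ x ≤ deriv u₂ x by linarith)
    have h' := mul_le_mul_of_nonneg_left hws hη.le
    rw [mul_add, mul_div_cancel₀ _ hη.ne'] at h'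
    linarith
  have hlow : ∀ x, 0 < a x → (lam₂ - lam₁) / C ≤ deriv u₂ x - deriv u₁ x := by
    intro x hx
    rw [← neg_le_neg_iff]
    refine le_of_degenerate_ode (w := fun x => -(deriv u₂ x - deriv u₁ x)) hκ ha0
      (fun x => (ha01 x).2) hac haq (fun x => by rw [abs_neg]; exact hwB x)
      (fun x hx => (hwd x hx).neg) ?_ hx
    intro s hs
    refine ⟨min (C * s) (lam₂ - lam₁), by positivity, fun x hx hws => ?_⟩
    rw [mul_neg, mul_div_cancel₀ _ hx.ne', neg_le_neg_iff]
    rcases le_total (deriv u₁ x) (deriv u₂ x) with hle | hle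
    · have h := hlip _ _ (r1 _ (c1 x hx).2).1 hle (r2 _ (c2 x hx).2).2
      have h' := mul_le_mul_of_nonneg_left hws hCpos.le
      rw [mul_add, mul_neg, mul_div_cancel₀ _ hCpos.ne'] at h'
      linarith [min_le_left (C * s) (lam₂ - lam₁)]
    · have h := hmono.le_sub (r2 _ (c2 x hx).2).1 hle
      have h' : 0 ≤ η * (deriv u₁ x - deriv u₂ x) := mul_nonneg hη.le (by linarith)
      linarith [min_le_right (C * s) (lam₂ - lam₁)]
  filter_upwards [d1, d2] with x hx1 hx2
  rcases (ha0 x).eq_or_lt with h0 | hpos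
  · obtain ⟨e1, m1⟩ := hx1 h0.symm
    obtain ⟨e2, m2⟩ := hx2 h0.symm
    have hle : deriv u₁ x ≤ deriv u₂ x := le_of_G_le hη hmono (r2 _ m2).1 (by linarith)
    have h1 := hlip _ _ (r1 _ m1).1 hle (r2 _ m2).2
    have h2 := hmono.le_sub (r1 _ m1).1 hle
    exact ⟨by rw [div_le_iff₀ hCpos]; linarith, by rw [le_div_iff₀ hη]; linarith⟩
  · exact ⟨hlow x hpos, hup x hpos⟩

lemma isLocalMax_comp_add_const {f : ℝ → ℝ} {x s : ℝ} (h : IsLocalMax (fun y => f (y + s)) x) :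
    IsLocalMax f (x + s) := by
  have ht : Filter.Tendsto (fun z => z - s) (nhds (x + s)) (nhds x) := by
    have : Continuous fun z : ℝ => z - s := by fun_prop
    simpa using this.tendsto (x + s)
  filter_upwards [ht.eventually h] with z hz
  simpa using hz

lemma isLocalMax_comp_neg {f : ℝ → ℝ} {x : ℝ} (h : IsLocalMax (fun y => f (-y)) x) :
    IsLocalMax f (-x) := by
  have ht : Filter.Tendsto (fun z => -z) (nhds (-x)) (nhds x) := by
    simpa using (continuous_neg (G := ℝ)).tendsto (-x)
  filter_upwards [ht.eventually h] with z hz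
  simpa using hz

lemma Splus_translate {a V G : ℝ → ℝ} {β lam : ℝ} {u : ℝ → ℝ} (hu : u ∈ Splus a V G β lam)
    (s c : ℝ) :
    (fun y => u (y + s) - c) ∈ Splus (fun y => a (y + s)) (fun y => V (y + s)) G β lam := by
  obtain ⟨⟨K, hK⟩, ⟨huc, hsub, hsup⟩, hae⟩ := hu
  have hφd : ∀ φ : ℝ → ℝ, ∀ x : ℝ, deriv (fun y => φ (y - s)) (x + s) = deriv φ x ∧
      deriv (deriv fun y => φ (y - s)) (x + s) = deriv (deriv φ) x := by
    intro φ x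
    have e : deriv (fun y => φ (y - s)) = fun y => deriv φ (y - s) :=
      funext fun y => deriv_comp_sub_const ..
    rw [e]
    constructor
    · simp
    · rw [deriv_comp_sub_const (f := deriv φ)]
      simp
  refine ⟨⟨K, ?_⟩, ⟨by fun_prop, ?_, ?_⟩, ?_⟩
  · refine LipschitzWith.of_dist_le_mul fun x y => ?_
    have := hK.dist_le_mul (x + s) (y + s)
    simpa using this
  · intro x φ hφ hmax
    have h := hsub (x + s) (fun y => φ (y - s)) (by fun_prop) (isLocalMax_comp_add_const (by
      filter_upwards [hmax] with y hy
      have hy : u (y + s) - c - φ y ≤ u (x + s) - c - φ x := hy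
      simp only [add_sub_cancel_right]
      linarith))
    rwa [(hφd φ x).1, (hφd φ x).2] at h
  · intro x φ hφ hmin
    have hloc : IsLocalMax (fun y => -(u y - φ (y - s))) (x + s) := isLocalMax_comp_add_const (by
      filter_upwards [hmin] with y hy
      have hy : u (x + s) - c - φ x ≤ u (y + s) - c - φ y := hy
      simp only [add_sub_cancel_right]
      linarith)
    have h := hsup (x + s) (fun y => φ (y - s)) (by fun_prop) (by simpa using hloc.neg)
    rwa [(hφd φ x).1, (hφd φ x).2] at h
  · have := (measurePreserving_add_right (volume : Measure ℝ) s).quasiMeasurePreserving.ae hae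
    filter_upwards [this] with y hy
    rwa [deriv_sub_const, deriv_comp_add_const]

lemma MemGsqc.comp_neg {G : ℝ → ℝ} (hG : MemGsqc G) : MemGsqc fun p => G (-p) := by
  obtain ⟨⟨α₀, α₁, γ, h0, h1, hγ, hgr, hL⟩, hz, η, hη, hmono⟩ := hG
  refine ⟨⟨α₀, α₁, γ, h0, h1, hγ, fun p => by simpa using hgr (-p), fun p q => ?_⟩, by simpa,
    η, hη, fun p q hp hpq => ?_⟩
  · have := hL (-p) (-q)
    rwa [abs_neg, abs_neg, neg_sub_neg, abs_sub_comm q p] at this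
  · simpa using (hmono p q hp hpq).symm

lemma StrictIncrRate.comp_neg {G : ℝ → ℝ} {η : ℝ} (h : StrictIncrRate G η) :
    StrictIncrRate (fun p => G (-p)) η := fun p q hp hpq => by
  simpa using (h p q hp hpq).symm

lemma GplusInv_comp_neg {G : ℝ → ℝ} {η y : ℝ} (hη : 0 < η) (hG : MemGsqc G)
    (hmono : StrictIncrRate G η) (hy : 0 ≤ y) :
    GplusInv (fun p => G (-p)) y = -GminusInv G y := by
  obtain ⟨h1, h2⟩ := GplusInv_spec hη hG.comp_neg hmono.comp_neg hy
  have hex : ∃ p ∈ Iic (0 : ℝ), G p = y := ⟨_, neg_nonpos.2 h1, h2⟩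
  have h3 : GminusInv G y ≤ 0 := Function.invFunOn_mem hex
  have h4 : G (GminusInv G y) = y := Function.invFunOn_eq hex
  apply le_antisymm
  · exact le_of_G_le hη hmono.comp_neg (neg_nonneg.2 h3) (by simp [h2, h4])
  · exact le_of_G_le hη hmono.comp_neg h1 (by simp [h2, h4])

lemma deriv_comp_neg_fun (φ : ℝ → ℝ) : deriv (fun y => φ (-y)) = fun y => -deriv φ (-y) :=
  funext fun y => deriv_comp_neg φ y

lemma deriv_deriv_comp_neg (φ : ℝ → ℝ) (x : ℝ) :
    deriv (deriv fun y => φ (-y)) x = deriv (deriv φ) (-x) := by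
  have e : deriv (fun y => -deriv φ (-y)) x = -deriv (fun y => deriv φ (-y)) x := deriv.fun_neg
  rw [deriv_comp_neg_fun, e, deriv_comp_neg (deriv φ), neg_neg]

lemma IsViscSol.comp_neg {a V G : ℝ → ℝ} {β lam : ℝ} {u : ℝ → ℝ}
    (hu : IsViscSol a V G β lam u) :
    IsViscSol (fun x => a (-x)) (fun x => V (-x)) (fun p => G (-p)) β lam (fun x => u (-x)) := by
  obtain ⟨huc, hsub, hsup⟩ := hu
  refine ⟨by fun_prop, ?_, ?_⟩
  · intro x φ hφ hmax
    have h := hsub (-x) (fun y => φ (-y)) (by fun_prop) (isLocalMax_comp_neg (by simpa using hmax))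
    rwa [deriv_deriv_comp_neg, deriv_comp_neg, neg_neg] at h
  · intro x φ hφ hmin
    have hloc : IsLocalMax (fun y => -(u y - φ (-y))) (-x) :=
      isLocalMax_comp_neg (by simpa using hmin.neg)
    have h := hsup (-x) (fun y => φ (-y)) (by fun_prop) (by simpa using hloc.neg)
    rwa [deriv_deriv_comp_neg, deriv_comp_neg, neg_neg] at h

lemma ae_comp_neg {p : ℝ → Prop} (h : ∀ᵐ x, p x) : ∀ᵐ x, p (-x) :=
  (Measure.measurePreserving_neg (volume : Measure ℝ)).quasiMeasurePreserving.ae h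

lemma LipschitzWith.comp_neg_real {K : NNReal} {u : ℝ → ℝ} (h : LipschitzWith K u) :
    LipschitzWith K fun x => u (-x) :=
  LipschitzWith.of_dist_le_mul fun x y => by simpa using h.dist_le_mul (-x) (-y)

lemma comp_neg_mem_Splus_iff {a V G : ℝ → ℝ} {β lam η : ℝ} {u : ℝ → ℝ} (hη : 0 < η)
    (hG : MemGsqc G) (hmono : StrictIncrRate G η) (hβ : 0 ≤ β) (hlam : β ≤ lam) :
    (fun x => u (-x)) ∈ Splus (fun x => a (-x)) (fun x => V (-x)) (fun p => G (-p)) β lam ↔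
      u ∈ Sminus a V G β lam := by
  have e1 := GplusInv_comp_neg hη hG hmono (hβ.trans hlam)
  have e2 := GplusInv_comp_neg hη hG hmono (sub_nonneg.2 hlam)
  constructor
  · rintro ⟨⟨K, hK⟩, hsol, hae⟩
    refine ⟨⟨K, by simpa using hK.comp_neg_real⟩, by simpa using hsol.comp_neg, ?_⟩
    filter_upwards [ae_comp_neg hae] with x hx
    rw [deriv_comp_neg, e1, e2, neg_neg] at hx
    exact ⟨neg_le_neg_iff.1 hx.2, neg_le_neg_iff.1 hx.1⟩
  · rintro ⟨⟨K, hK⟩, hsol, hae⟩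
    refine ⟨⟨K, hK.comp_neg_real⟩, hsol.comp_neg, ?_⟩
    filter_upwards [ae_comp_neg hae] with x hx
    rw [deriv_comp_neg, e1, e2]
    exact ⟨neg_le_neg hx.2, neg_le_neg hx.1⟩

lemma hasDerivAt_zero_iff_rat {f : ℝ → ℝ} (hf : Continuous f) (c : ℝ) :
    HasDerivAt f c 0 ↔ Filter.Tendsto (fun q : ℚ => slope f 0 (q : ℝ))
      (Filter.comap ((↑) : ℚ → ℝ) (nhdsWithin 0 {0}ᶜ)) (nhds c) := by
  rw [hasDerivAt_iff_tendsto_slope]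
  refine ⟨fun h => h.comp Filter.tendsto_comap, fun h => ?_⟩
  rw [Metric.tendsto_nhds] at h ⊢
  intro ε hε
  obtain ⟨t, ht, hts⟩ := Filter.mem_comap.1 (h (ε / 2) (half_pos hε))
  obtain ⟨O, hO, hO0, hOt⟩ := mem_nhdsWithin.1 ht
  refine mem_nhdsWithin.2 ⟨O, hO, hO0, fun x hx => ?_⟩
  have hopen : IsOpen (O ∩ {0}ᶜ) := hO.inter isOpen_compl_singleton
  have hcl : x ∈ closure (O ∩ {0}ᶜ ∩ range ((↑) : ℚ → ℝ)) :=
    (Rat.isDenseEmbedding_coe_real.dense.open_subset_closure_inter hopen) hx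
  have hsc : ContinuousAt (fun y => dist (slope f 0 y) c) x := by
    have hx0 : x - 0 ≠ 0 := by simpa using hx.2
    have : ContinuousAt (fun y => (f y - f 0) / (y - 0)) x :=
      ContinuousAt.div (by fun_prop) (by fun_prop) hx0
    simp only [← slope_def_field] at this
    exact this.dist continuousAt_const
  have hle : dist (slope f 0 x) c ≤ ε / 2 := by
    refine isClosed_Iic.mem_of_frequently_of_tendsto (s := Iic (ε / 2))
      ((mem_closure_iff_frequently.1 hcl).mono ?_) hsc
    rintro _ ⟨hy, q, rfl⟩
    have h' : dist (slope f 0 (q : ℝ)) c < ε / 2 := hts (hOt hy)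
    exact h'.le
  exact hle.trans_lt (half_lt_self hε)

/-- The derivative at `0` of a measurable family of continuous functions is measurable. -/
lemma measurable_deriv_at_zero {Ω : Type*} [MeasurableSpace Ω] {U : ℝ → Ω → ℝ}
    (hm : ∀ x, Measurable (U x)) (hc : ∀ ω, Continuous fun x => U x ω) :
    Measurable fun ω => deriv (fun x => U x ω) 0 := by
  set l : Filter ℚ := Filter.comap ((↑) : ℚ → ℝ) (nhdsWithin 0 {0}ᶜ) with hl
  have hne : l.NeBot := by
    refine Filter.comap_neBot fun t ht => ?_
    obtain ⟨O, hO, hO0, hOt⟩ := mem_nhdsWithin.1 ht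
    have hopen : IsOpen (O ∩ {0}ᶜ) := hO.inter isOpen_compl_singleton
    have hnon : (O ∩ {0}ᶜ).Nonempty := by
      have : (nhdsWithin (0 : ℝ) {0}ᶜ).NeBot := inferInstance
      exact this.nonempty_of_mem (mem_nhdsWithin.2 ⟨O, hO, hO0, le_rfl⟩)
    obtain ⟨_, hq, q, rfl⟩ := Rat.isDenseEmbedding_coe_real.dense.inter_open_nonempty _ hopen hnon
    exact ⟨q, hOt hq⟩
  have hsm : ∀ q : ℚ, Measurable fun ω => slope (fun x => U x ω) 0 (q : ℝ) := fun q => by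
    simp only [slope_def_field]
    exact ((hm _).sub (hm _)).div_const _
  have hD : MeasurableSet {ω | ∃ c, Filter.Tendsto
      (fun q : ℚ => slope (fun x => U x ω) 0 (q : ℝ)) l (nhds c)} :=
    measurableSet_exists_tendsto hsm
  set D := {ω | ∃ c, Filter.Tendsto
      (fun q : ℚ => slope (fun x => U x ω) 0 (q : ℝ)) l (nhds c)} with hDdef
  refine measurable_of_tendsto_metrizable' l
    (f := fun q : ℚ => D.indicator fun ω => slope (fun x => U x ω) 0 (q : ℝ))
    (fun q => (hsm q).indicator hD) (tendsto_pi_nhds.2 fun ω => ?_)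
  by_cases hω : ω ∈ D
  · simp only [indicator_of_mem hω]
    obtain ⟨c, hcω⟩ := hω
    have := (hasDerivAt_zero_iff_rat (hc ω) c).2 hcω
    rwa [this.deriv]
  · simp only [indicator_of_notMem hω]
    have : ¬DifferentiableAt ℝ (fun x => U x ω) 0 := fun hd =>
      hω ⟨_, (hasDerivAt_zero_iff_rat (hc ω) _).1 hd.hasDerivAt⟩
    rw [deriv_zero_of_not_differentiableAt this]
    exact tendsto_const_nhds

/-- A measurable event met at almost every time along every orbit is almost sure. -/
lemma ae_mem_of_flow {Ω : Type*} [MeasurableSpace Ω] {P : Measure Ω} [IsProbabilityMeasure P]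
    {τ : ℝ → Ω → Ω} (hτ_meas : Measurable (fun p : ℝ × Ω => τ p.1 p.2))
    (hτ_mp : ∀ x : ℝ, MeasurePreserving (τ x) P P) {S : Set Ω} (hS : MeasurableSet S)
    (h : ∀ ω, ∀ᵐ x : ℝ, τ x ω ∈ S) : ∀ᵐ ω ∂P, ω ∈ S := by
  have hcomm := (Measure.ae_ae_comm (μ := (volume : Measure ℝ)) (ν := P)
    (p := fun x ω => τ x ω ∈ S) (hτ_meas hS)).2 (Filter.Eventually.of_forall h)
  obtain ⟨x, hx⟩ := hcomm.exists
  rw [ae_iff] at hx ⊢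
  rw [← hx]
  exact ((hτ_mp x).measure_preimage hS.compl.nullMeasurableSet).symm

/-- Range and increment bounds for the mean slope of the increasing stationary solutions. -/
lemma theta_plus_bounds
    {Ω : Type*} [MeasurableSpace Ω] (P : Measure Ω) [IsProbabilityMeasure P]
    (τ : ℝ → Ω → Ω)
    (hτ_meas : Measurable (fun p : ℝ × Ω => τ p.1 p.2))
    (hτ_add : ∀ x y : ℝ, ∀ ω, τ (x + y) ω = τ x (τ y ω))
    (hτ_mp : ∀ x : ℝ, MeasurePreserving (τ x) P P)
    (a V : ℝ → Ω → ℝ) (κ : ℝ) (hκ : 0 < κ)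
    (ha_range : ∀ x ω, a x ω ∈ Set.Icc (0 : ℝ) 1)
    (ha_lip : ∀ ω, LipschitzWith (Real.toNNReal κ) (fun x => Real.sqrt (a x ω)))
    (hV_lip : ∀ ω, LipschitzWith (Real.toNNReal κ) (fun x => V x ω))
    (ha_stat : ∀ x ω, a x ω = a 0 (τ x ω))
    (hV_stat : ∀ x ω, V x ω = V 0 (τ x ω))
    (β : ℝ) (hβ : 0 ≤ β)
    (G : ℝ → ℝ) (η : ℝ) (hη : 0 < η)
    (hG : MemGsqc G) (hG_mono : StrictIncrRate G η)
    (Up : ℝ → ℝ → Ω → ℝ)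
    (hUp : ∀ lam : ℝ, β ≤ lam →
      Measurable (fun p : ℝ × Ω => Up lam p.1 p.2) ∧
      ∀ ω, (fun x => Up lam x ω) ∈ Splus (fun x => a x ω) (fun x => V x ω) G β lam ∧
        Up lam 0 ω = 0 ∧
        ∀ v ∈ Splus (fun x => a x ω) (fun x => V x ω) G β lam,
          v 0 = 0 → v = fun x => Up lam x ω)
    (θp : ℝ → ℝ)
    (hθp : ∀ lam : ℝ, β ≤ lam → θp lam = ∫ ω, deriv (fun x => Up lam x ω) 0 ∂P) :
    (∀ lam : ℝ, β ≤ lam → θp lam ∈ Set.Icc (GplusInv G (lam - β)) (GplusInv G lam)) ∧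
    (∀ lam₁ lam₂ : ℝ, β ≤ lam₁ → lam₁ < lam₂ → ∀ R CR : ℝ, GplusInv G lam₂ ≤ R →
      LipschitzOnWith (Real.toNNReal CR) G (Set.Icc (-R) R) →
        (lam₂ - lam₁) / CR ≤ θp lam₂ - θp lam₁ ∧ θp lam₂ - θp lam₁ ≤ (lam₂ - lam₁) / η) := by
  have hstat : ∀ lam, β ≤ lam → ∀ x ω,
      deriv (fun y => Up lam y (τ x ω)) 0 = deriv (fun y => Up lam y ω) x := by
    intro lam hlam x ω
    have h := Splus_translate ((hUp lam hlam).2 ω).1 x (Up lam x ω)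
    have ea : (fun y => a (y + x) ω) = fun y => a y (τ x ω) := funext fun y => by
      rw [ha_stat, ha_stat y, hτ_add]
    have eV : (fun y => V (y + x) ω) = fun y => V y (τ x ω) := funext fun y => by
      rw [hV_stat, hV_stat y, hτ_add]
    rw [ea, eV] at h
    have hv := ((hUp lam hlam).2 (τ x ω)).2.2 _ h (by simp)
    rw [← hv, deriv_sub_const, deriv_comp_add_const (f := fun y => Up lam y ω), zero_add]
  have hmeas : ∀ lam, β ≤ lam → Measurable fun ω => deriv (fun y => Up lam y ω) 0 := by
    intro lam hlam
    exact measurable_deriv_at_zero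
      (fun x => (hUp lam hlam).1.comp measurable_prodMk_left)
      (fun ω => ((hUp lam hlam).2 ω).1.2.1.1)
  have hmem : ∀ lam, β ≤ lam → ∀ᵐ ω ∂P, deriv (fun y => Up lam y ω) 0 ∈
      Set.Icc (GplusInv G (lam - β)) (GplusInv G lam) := by
    intro lam hlam
    refine ae_mem_of_flow (S := {ω | deriv (fun y => Up lam y ω) 0 ∈
      Set.Icc (GplusInv G (lam - β)) (GplusInv G lam)}) hτ_meas hτ_mp
      (hmeas lam hlam measurableSet_Icc) fun ω => ?_
    filter_upwards [((hUp lam hlam).2 ω).1.2.2] with x hx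
    rwa [hstat lam hlam]
  have hint : ∀ lam, β ≤ lam → Integrable (fun ω => deriv (fun y => Up lam y ω) 0) P :=
    fun lam hlam => Integrable.of_mem_Icc _ _ (hmeas lam hlam).aemeasurable (hmem lam hlam)
  have hmean : ∀ {f : Ω → ℝ} {c d : ℝ}, Integrable f P → (∀ᵐ ω ∂P, f ω ∈ Icc c d) →
      ∫ ω, f ω ∂P ∈ Icc c d := by
    intro f c d hf hcd
    have h1 := integral_mono_ae (integrable_const c) hf (hcd.mono fun ω h => h.1)
    have h2 := integral_mono_ae hf (integrable_const d) (hcd.mono fun ω h => h.2)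
    simp only [integral_const, probReal_univ, one_smul] at h1 h2
    exact ⟨h1, h2⟩
  refine ⟨fun lam hlam => ?_, fun lam₁ lam₂ h₁ h₁₂ R CR hR hC => ?_⟩
  · rw [hθp lam hlam]
    exact hmean (hint lam hlam) (hmem lam hlam)
  · have h₂ : β ≤ lam₂ := h₁.trans h₁₂.le
    rw [hθp _ h₁, hθp _ h₂, ← integral_sub (hint _ h₂) (hint _ h₁)]
    refine hmean ((hint _ h₂).sub (hint _ h₁)) ?_
    refine ae_mem_of_flow (S := {ω | deriv (fun y => Up lam₂ y ω) 0 -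
        deriv (fun y => Up lam₁ y ω) 0 ∈ Icc ((lam₂ - lam₁) / CR) ((lam₂ - lam₁) / η)})
      hτ_meas hτ_mp
      (((hmeas _ h₂).sub (hmeas _ h₁)) measurableSet_Icc) fun ω => ?_
    filter_upwards [ae_deriv_sub_mem_Icc hκ hη hG hG_mono (fun x => ha_range x ω) (ha_lip ω)
      (hV_lip ω).continuous hβ h₁ h₁₂ ((hUp _ h₁).2 ω).1 ((hUp _ h₂).2 ω).1 hR hC] with x hx
    rwa [hstat _ h₁, hstat _ h₂]

/-- Range and increment bounds imply strict monotonicity and coercivity. -/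
lemma strictMonoOn_and_tendsto_of_bounds {G : ℝ → ℝ} {β η : ℝ} {θ : ℝ → ℝ}
    (hη : 0 < η) (hG : MemGsqc G) (hmono : StrictIncrRate G η)
    (h1 : ∀ lam : ℝ, β ≤ lam → GplusInv G (lam - β) ≤ θ lam)
    (h2 : ∀ lam₁ lam₂ : ℝ, β ≤ lam₁ → lam₁ < lam₂ → ∀ R CR : ℝ, GplusInv G lam₂ ≤ R →
      LipschitzOnWith (Real.toNNReal CR) G (Set.Icc (-R) R) →
        (lam₂ - lam₁) / CR ≤ θ lam₂ - θ lam₁) :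
    StrictMonoOn θ (Ici β) ∧ Filter.Tendsto θ Filter.atTop Filter.atTop := by
  constructor
  · intro x hx y hy hxy
    obtain ⟨C, hC⟩ := hG.1.exists_lipschitzOnWith (GplusInv G y)
    have hC1 : LipschitzOnWith (Real.toNNReal (max C 1)) G
        (Icc (-GplusInv G y) (GplusInv G y)) :=
      hC.weaken (Real.toNNReal_le_toNNReal (le_max_left _ _))
    have h := h2 x y hx hxy _ _ le_rfl hC1
    have : 0 < (y - x) / max C 1 := div_pos (by linarith) (by positivity)
    linarith
  · refine Filter.tendsto_atTop.2 fun N => ?_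
    set N' := max N 0 with hN'
    filter_upwards [Filter.eventually_ge_atTop (β + max (G N') 0)] with lam hlam
    have hle : β ≤ lam := by linarith [le_max_right (G N') 0]
    obtain ⟨b1, b2⟩ := GplusInv_spec hη hG hmono (sub_nonneg.2 hle)
    have : N' ≤ GplusInv G (lam - β) :=
      le_of_G_le hη hmono b1 (by rw [b2]; linarith [le_max_left (G N') 0])
    exact (le_max_left N 0).trans (this.trans (h1 lam hle))

theorem properties_of_theta_plus_minus
    {Ω : Type*} [MeasurableSpace Ω] (P : Measure Ω) [IsProbabilityMeasure P]
    (τ : ℝ → Ω → Ω)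
    (hτ_meas : Measurable (fun p : ℝ × Ω => τ p.1 p.2))
    (hτ_zero : ∀ ω, τ 0 ω = ω)
    (hτ_add : ∀ x y : ℝ, ∀ ω, τ (x + y) ω = τ x (τ y ω))
    (hτ_mp : ∀ x : ℝ, MeasurePreserving (τ x) P P)
    (hτ_erg : ∀ g : Ω → ℝ, Measurable g →
      (∀ x : ℝ, ∀ᵐ ω ∂P, g (τ x ω) = g ω) → ∃ c : ℝ, ∀ᵐ ω ∂P, g ω = c)
    (a V : ℝ → Ω → ℝ) (κ : ℝ) (hκ : 0 < κ)
    (ha_meas : Measurable (fun p : ℝ × Ω => a p.1 p.2))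
    (hV_meas : Measurable (fun p : ℝ × Ω => V p.1 p.2))
    (ha_range : ∀ x ω, a x ω ∈ Set.Icc (0 : ℝ) 1)
    (hV_range : ∀ x ω, V x ω ∈ Set.Icc (0 : ℝ) 1)
    (ha_lip : ∀ ω, LipschitzWith (Real.toNNReal κ) (fun x => Real.sqrt (a x ω)))
    (hV_lip : ∀ ω, LipschitzWith (Real.toNNReal κ) (fun x => V x ω))
    (ha_stat : ∀ x ω, a x ω = a 0 (τ x ω))
    (hV_stat : ∀ x ω, V x ω = V 0 (τ x ω))
    (β : ℝ) (hβ : 0 ≤ β)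
    (G : ℝ → ℝ) (η : ℝ) (hη : 0 < η)
    (hG : MemGsqc G) (hG_mono : StrictIncrRate G η)
    (Up Um : ℝ → ℝ → Ω → ℝ)
    (hUp : ∀ lam : ℝ, β ≤ lam →
      Measurable (fun p : ℝ × Ω => Up lam p.1 p.2) ∧
      ∀ ω, (fun x => Up lam x ω) ∈ Splus (fun x => a x ω) (fun x => V x ω) G β lam ∧
        Up lam 0 ω = 0 ∧
        ∀ v ∈ Splus (fun x => a x ω) (fun x => V x ω) G β lam,
          v 0 = 0 → v = fun x => Up lam x ω)
    (hUm : ∀ lam : ℝ, β ≤ lam →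
      Measurable (fun p : ℝ × Ω => Um lam p.1 p.2) ∧
      ∀ ω, (fun x => Um lam x ω) ∈ Sminus (fun x => a x ω) (fun x => V x ω) G β lam ∧
        Um lam 0 ω = 0 ∧
        ∀ v ∈ Sminus (fun x => a x ω) (fun x => V x ω) G β lam,
          v 0 = 0 → v = fun x => Um lam x ω)
    (θp θm : ℝ → ℝ)
    (hθp : ∀ lam : ℝ, β ≤ lam → θp lam = ∫ ω, deriv (fun x => Up lam x ω) 0 ∂P)
    (hθm : ∀ lam : ℝ, β ≤ lam → θm lam = ∫ ω, deriv (fun x => Um lam x ω) 0 ∂P) :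
    -- (i)
    (∀ lam : ℝ, β ≤ lam →
      θm lam ∈ Set.Icc (GminusInv G lam) (GminusInv G (lam - β)) ∧
      θp lam ∈ Set.Icc (GplusInv G (lam - β)) (GplusInv G lam)) ∧
    -- (ii)
    (∀ lam₁ lam₂ : ℝ, β ≤ lam₁ → lam₁ < lam₂ →
      ∀ R CR : ℝ, R = max (-(GminusInv G lam₂)) (GplusInv G lam₂) →
        LipschitzOnWith (Real.toNNReal CR) G (Set.Icc (-R) R) →
          (lam₂ - lam₁) / CR ≤ θm lam₁ - θm lam₂ ∧
          θm lam₁ - θm lam₂ ≤ (lam₂ - lam₁) / η ∧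
          (lam₂ - lam₁) / CR ≤ θp lam₂ - θp lam₁ ∧
          θp lam₂ - θp lam₁ ≤ (lam₂ - lam₁) / η) ∧
    -- in particular: strict monotonicity and coercivity on [β, +∞)
    StrictMonoOn θp (Set.Ici β) ∧ StrictAntiOn θm (Set.Ici β) ∧
    Filter.Tendsto θp Filter.atTop Filter.atTop ∧
    Filter.Tendsto θm Filter.atTop Filter.atBot := by
  obtain ⟨p1, p2⟩ := theta_plus_bounds P τ hτ_meas hτ_add hτ_mp a V κ hκ ha_range ha_lip hV_lip
    ha_stat hV_stat β hβ G η hη hG hG_mono Up hUp θp hθp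
  have hneg : Measurable fun p : ℝ × Ω => (-p.1, p.2) :=
    (measurable_fst.neg).prodMk measurable_snd
  obtain ⟨m1, m2⟩ := theta_plus_bounds P (fun x => τ (-x)) (hτ_meas.comp hneg)
    (fun x y ω => by rw [neg_add, hτ_add]) (fun x => hτ_mp (-x)) (fun x => a (-x))
    (fun x => V (-x)) κ hκ (fun x => ha_range (-x)) (fun ω => (ha_lip ω).comp_neg_real)
    (fun ω => (hV_lip ω).comp_neg_real)
    (fun x ω => by rw [neg_zero]; exact ha_stat (-x) ω)
    (fun x ω => by rw [neg_zero]; exact hV_stat (-x) ω) β hβ (fun p => G (-p)) η hη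
    hG.comp_neg hG_mono.comp_neg (fun lam x => Um lam (-x))
    (fun lam hlam => by
      obtain ⟨hm, hω⟩ := hUm lam hlam
      refine ⟨hm.comp hneg, fun ω => ?_⟩
      obtain ⟨q1, q2, q3⟩ := hω ω
      refine ⟨(comp_neg_mem_Splus_iff hη hG hG_mono hβ hlam).2 q1, by simpa using q2, ?_⟩
      intro v hv hv0
      have := q3 (fun x => v (-x))
        ((comp_neg_mem_Splus_iff hη hG hG_mono hβ hlam).1 (by simpa using hv)) (by simpa using hv0)
      funext x
      simpa using congrFun this (-x))
    (fun lam => -θm lam)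
    (fun lam hlam => by
      rw [hθm lam hlam, ← integral_neg]
      congr 1
      funext ω
      simpa using (deriv_comp_neg (fun x => Um lam x ω) 0).symm)
  have hinv : ∀ y, 0 ≤ y → GplusInv (fun p => G (-p)) y = -GminusInv G y := fun y hy =>
    GplusInv_comp_neg hη hG hG_mono hy
  have hlip_neg : ∀ R CR : ℝ, LipschitzOnWith (Real.toNNReal CR) G (Set.Icc (-R) R) →
      LipschitzOnWith (Real.toNNReal CR) (fun p => G (-p)) (Set.Icc (-R) R) := by
    intro R CR h
    refine LipschitzOnWith.of_dist_le_mul fun x hx y hy => ?_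
    have := h.dist_le_mul (-x) ⟨by linarith [hx.2], by linarith [hx.1]⟩ (-y)
      ⟨by linarith [hy.2], by linarith [hy.1]⟩
    rwa [dist_neg_neg] at this
  obtain ⟨sp, tp⟩ := strictMonoOn_and_tendsto_of_bounds hη hG hG_mono
    (fun lam hlam => (p1 lam hlam).1)
    (fun l₁ l₂ h₁ h₂ R CR hR hC => (p2 l₁ l₂ h₁ h₂ R CR hR hC).1)
  obtain ⟨sm, tm⟩ := strictMonoOn_and_tendsto_of_bounds hη hG.comp_neg hG_mono.comp_neg
    (fun lam hlam => (m1 lam hlam).1)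
    (fun l₁ l₂ h₁ h₂ R CR hR hC => (m2 l₁ l₂ h₁ h₂ R CR hR hC).1)
  refine ⟨fun lam hlam => ⟨?_, p1 lam hlam⟩, ?_, sp, ?_, tp, ?_⟩
  · have h := m1 lam hlam
    rw [hinv _ (hβ.trans hlam), hinv _ (sub_nonneg.2 hlam)] at h
    exact ⟨neg_le_neg_iff.1 h.2, neg_le_neg_iff.1 h.1⟩
  · intro l₁ l₂ h₁ h₂ R CR hR hC
    obtain ⟨c1, c2⟩ := p2 l₁ l₂ h₁ h₂ R CR (by rw [hR]; exact le_max_right _ _) hC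
    obtain ⟨d1, d2⟩ := m2 l₁ l₂ h₁ h₂ R CR
      (by rw [hR, hinv _ (hβ.trans (h₁.trans h₂.le))]; exact le_max_left _ _) (hlip_neg R CR hC)
    rw [neg_sub_neg] at d1 d2
    exact ⟨d1, d2, c1, c2⟩
  · exact fun x hx y hy hxy => neg_lt_neg_iff.1 (sm hx hy hxy)
  · exact Filter.tendsto_neg_atTop_iff.1 tm
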